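/- arXiv:1402.4340 — 6 statements merged into one kernel-verified Lean document; each statement's English description precedes it below -/
import Mathlib

section
/- Let n ≥ 1, k ≥ 0 be integers and α, β > 0 real numbers with α < 2β. For 0 < μ ≤ 1, let λ_k(μ) denote the unique positive real λ with (2k+n)^α λ^α + λ^{2β} = μ. Then (μ/2)^{1/α}/(2k+n) ≤ λ_k(μ) ≤ μ^{1/α}/(2k+n). -/
/-- For integers `n ≥ 1`, `k ≥ 0`, reals `α, β > 0` with `α < 2β` and
`0 < μ ≤ 1`, the unique positive solution `l` of `(2k+n)^α l^α + l^(2β) = μ` satisfies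
`(μ/2)^(1/α)/(2k+n) ≤ l ≤ μ^(1/α)/(2k+n)`. -/
theorem stmt5 (n k : ℕ) (hn : 1 ≤ n) (α β : ℝ) (hα : 0 < α) (hβ : 0 < β)
    (hαβ : α < 2 * β) (μ : ℝ) (hμ0 : 0 < μ) (hμ1 : μ ≤ 1)
    (l : ℝ) (hl : 0 < l)
    (heq : (2 * k + n : ℝ) ^ α * l ^ α + l ^ (2 * β) = μ) :
    (μ / 2) ^ (1 / α) / (2 * k + n : ℝ) ≤ l ∧ l ≤ μ ^ (1 / α) / (2 * k + n : ℝ) := by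
  have hm : (1 : ℝ) ≤ 2 * k + n := by
    have : (1 : ℝ) ≤ n := by exact_mod_cast hn
    have : (0 : ℝ) ≤ k := k.cast_nonneg
    linarith
  generalize (2 * k + n : ℝ) = m at *
  have hm0 : 0 < m := by linarith
  rw [← Real.mul_rpow hm0.le hl.le] at heq
  have hml : 0 < m * l := mul_pos hm0 hl
  have hpos : 0 < (m * l) ^ α := Real.rpow_pos_of_pos hml α
  have hpos' : 0 < l ^ (2 * β) := Real.rpow_pos_of_pos hl _
  have hl1 : l ≤ 1 := by
    by_contra! h
    have := Real.one_lt_rpow h (by linarith : 0 < 2 * β)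
    linarith
  have hdom : l ^ (2 * β) ≤ (m * l) ^ α :=
    (Real.rpow_le_rpow_of_exponent_ge hl hl1 hαβ.le).trans
      (Real.rpow_le_rpow hl.le (le_mul_of_one_le_left hl.le hm) hα.le)
  have hroot : ((m * l) ^ α) ^ (1 / α) = m * l := by
    rw [one_div, Real.rpow_rpow_inv hml.le hα.ne']
  rw [div_le_iff₀' hm0, le_div_iff₀' hm0, ← hroot]
  have hα' : 0 ≤ 1 / α := by positivity
  exact ⟨Real.rpow_le_rpow (by linarith) (by linarith) hα',
    Real.rpow_le_rpow hpos.le (by linarith) hα'⟩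
end

section
/- Let n ≥ 1, k ≥ 0 be integers, α, β > 0 real numbers with α < 2β, and μ > 0. Let λ_k(μ) denote the unique positive real λ with (2k+n)^α λ^α + λ^{2β} = μ. If (2k+n)^α λ_k(μ)^α ≥ λ_k(μ)^{2β}, then 2k+n ≥ (μ/2)^{(2β−α)/(2αβ)}. If instead (2k+n)^α λ_k(μ)^α < λ_k(μ)^{2β}, then 2k+n < μ^{(2β−α)/(2αβ)}. -/
/-- For integers `n ≥ 1`, `k ≥ 0`, reals `α, β > 0` with `α < 2β`, `μ > 0`,
let `l` be the unique positive solution of `(2k+n)^α l^α + l^(2β) = μ`. If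
`(2k+n)^α l^α ≥ l^(2β)` then `2k+n ≥ (μ/2)^((2β−α)/(2αβ))`; if `(2k+n)^α l^α < l^(2β)`
then `2k+n < μ^((2β−α)/(2αβ))`. -/
theorem stmt7 (n k : ℕ) (hn : 1 ≤ n) (α β : ℝ) (hα : 0 < α) (hβ : 0 < β)
    (hαβ : α < 2 * β) (μ : ℝ) (hμ : 0 < μ) (l : ℝ) (hl : 0 < l)
    (heq : (2 * k + n : ℝ) ^ α * l ^ α + l ^ (2 * β) = μ) :
    (l ^ (2 * β) ≤ (2 * k + n : ℝ) ^ α * l ^ α →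
      (μ / 2) ^ ((2 * β - α) / (2 * α * β)) ≤ (2 * k + n : ℝ)) ∧
    ((2 * k + n : ℝ) ^ α * l ^ α < l ^ (2 * β) →
      (2 * k + n : ℝ) < μ ^ ((2 * β - α) / (2 * α * β))) := by
  have hN : (0 : ℝ) < 2 * k + n := by
    have : (1 : ℝ) ≤ n := by exact_mod_cast hn
    positivity
  generalize (2 * k + n : ℝ) = N at *
  have hd : 0 < 2 * β - α := sub_pos.mpr hαβ
  have hc : 0 < 2 * α * β := by positivity
  have hNα : 0 < N ^ α := Real.rpow_pos_of_pos hN _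
  have hlα : 0 < l ^ α := Real.rpow_pos_of_pos hl _
  have hlβ : 0 < l ^ (2 * β) := Real.rpow_pos_of_pos hl _
  have hlog : Real.log (N ^ α * l ^ α) = α * Real.log N + α * Real.log l := by
    rw [Real.log_mul hNα.ne' hlα.ne', Real.log_rpow hN, Real.log_rpow hl]
  have hlogβ : Real.log (l ^ (2 * β)) = 2 * β * Real.log l := Real.log_rpow hl _
  constructor
  · intro h
    have h₁ := Real.log_le_log hlβ h
    have h₂ : Real.log (μ / 2) ≤ Real.log (N ^ α * l ^ α) :=
      Real.log_le_log (by positivity) (by linarith)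
    rw [hlog] at h₁ h₂
    rw [hlogβ] at h₁
    rw [← Real.log_le_log_iff (by positivity) hN, Real.log_rpow (by positivity),
      div_mul_eq_mul_div, div_le_iff₀ hc]
    nlinarith [mul_le_mul_of_nonneg_left h₂ hd.le, mul_le_mul_of_nonneg_left h₁ hα.le]
  · intro h
    have h₁ := Real.log_lt_log (by positivity) h
    have h₂ : Real.log (l ^ (2 * β)) < Real.log μ :=
      Real.log_lt_log hlβ (by linarith [mul_pos hNα hlα])
    rw [hlogβ] at h₁ h₂
    rw [hlog] at h₁
    rw [← Real.log_lt_log_iff hN (by positivity), Real.log_rpow hμ,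
      div_mul_eq_mul_div, lt_div_iff₀ hc]
    nlinarith [mul_lt_mul_of_pos_left h₂ hd, mul_lt_mul_of_pos_left h₁ hβ]
end

section
/- Let n ≥ 1 and m ≥ 2 be integers, α, β > 0 real with α < 2β, and 1 ≤ p ≤ (2m+2)/(m+3). Set a = 2n(1/p − 1/2) − 1 and b = 2(n+m)(1/p − 1/2) − 1. For μ > 0 let λ_k(μ) be the unique positive real λ with (2k+n)^α λ^α + λ^{2β} = μ, and set λ_k'(μ) = 1/(α(2k+n)^α λ_k(μ)^{α−1} + 2β λ_k(μ)^{2β−1}). Then there exists a constant C > 0, depending only on n, m, p, α, β, such that for every μ with 0 < μ ≤ 1 the series ∑_{k=0}^∞ (2k+n)^a · λ_k(μ)^b · λ_k'(μ) converges and is at most C · μ^{(2/α)(n+m)(1/p−1/2) − 1}. -/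
/-- Solutions of `x^α t^α + t^γ = μ` satisfy `t ≤ μ^(1/α) / x`. -/
lemma le_rpow_div_of_mul_rpow_add_rpow_eq {α γ x t μ : ℝ} (hα : 0 < α) (hx : 0 < x) (ht : 0 < t)
    (h : x ^ α * t ^ α + t ^ γ = μ) : t ≤ μ ^ (1 / α) / x := by
  rw [le_div_iff₀ hx, mul_comm]
  have h1 : (x * t) ^ α ≤ μ := by
    rw [Real.mul_rpow hx.le ht.le]
    linarith [Real.rpow_pos_of_pos ht γ]
  have h2 := Real.rpow_le_rpow (by positivity) h1 (one_div_pos.mpr hα).le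
  rwa [← Real.rpow_mul (by positivity), mul_one_div_cancel hα.ne', Real.rpow_one] at h2

/-- Pointwise bound for a term of the restriction series. -/
lemma rpow_mul_rpow_mul_deriv_le {α γ x t μ a b : ℝ} (hα : 0 < α) (hαγ : α ≤ γ) (hx : 0 < x)
    (ht : 0 < t) (hμ : 0 < μ) (hb : 0 ≤ b) (h : x ^ α * t ^ α + t ^ γ = μ) :
    x ^ a * t ^ (b - 1) * (1 / (α * x ^ α * t ^ (α - 1) + γ * t ^ (γ - 1))) ≤
      1 / α * μ ^ (b / α - 1) * x ^ (a - b) := by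
  have hγ : 0 < γ := hα.trans_le hαγ
  have hxα := Real.rpow_pos_of_pos hx α
  have htα := Real.rpow_pos_of_pos ht α
  have htγ := Real.rpow_pos_of_pos ht γ
  have e : t ^ (b - 1) * (1 / (α * x ^ α * t ^ (α - 1) + γ * t ^ (γ - 1))) =
      t ^ b / (α * (x ^ α * t ^ α) + γ * t ^ γ) := by
    rw [Real.rpow_sub_one ht.ne', Real.rpow_sub_one ht.ne', Real.rpow_sub_one ht.ne']
    field_simp
  have hden : α * μ ≤ α * (x ^ α * t ^ α) + γ * t ^ γ := by
    rw [← h]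
    nlinarith
  have htb : t ^ b ≤ μ ^ (b / α) / x ^ b := by
    have h1 := Real.rpow_le_rpow ht.le (le_rpow_div_of_mul_rpow_add_rpow_eq hα hx ht h) hb
    rwa [Real.div_rpow (by positivity) hx.le, ← Real.rpow_mul hμ.le, one_div_mul_eq_div] at h1
  rw [mul_assoc, e]
  calc x ^ a * (t ^ b / (α * (x ^ α * t ^ α) + γ * t ^ γ))
      ≤ x ^ a * (μ ^ (b / α) / x ^ b / (α * μ)) := by gcongr
    _ = 1 / α * μ ^ (b / α - 1) * x ^ (a - b) := by
      rw [Real.rpow_sub_one hμ.ne', Real.rpow_sub hx]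
      field_simp

lemma summable_two_mul_add_rpow {n : ℕ} (hn : 1 ≤ n) {q : ℝ} (hq : q < -1) :
    Summable fun k : ℕ => (2 * k + n : ℝ) ^ q := by
  have hn' : (1 : ℝ) ≤ n := by exact_mod_cast hn
  refine Summable.of_nonneg_of_le (fun k => by positivity) (fun k => ?_)
    ((summable_nat_add_iff 1).mpr (Real.summable_nat_rpow.mpr hq))
  have hk : (0 : ℝ) ≤ k := k.cast_nonneg
  refine Real.rpow_le_rpow_of_nonpos (by positivity) ?_ (by linarith)
  push_cast
  linarith


/-- (case `α < 2β`, `0 < μ ≤ 1`) Bound for the series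
`∑_k (2k+n)^a (lam k μ)^b (lam k μ)'` by `C μ^((2/α)(n+m)(1/p−1/2) − 1)`. -/
theorem stmt8 (n m : ℕ) (hn : 1 ≤ n) (hm : 2 ≤ m) (α β : ℝ) (hα : 0 < α) (hβ : 0 < β)
    (hαβ : α < 2 * β) (p : ℝ) (hp1 : 1 ≤ p) (hp2 : p ≤ (2 * m + 2) / (m + 3))
    (lam : ℕ → ℝ → ℝ)
    (hlam : ∀ k : ℕ, ∀ μ : ℝ, 0 < μ → 0 < lam k μ ∧
      (2 * k + n : ℝ) ^ α * (lam k μ) ^ α + (lam k μ) ^ (2 * β) = μ) :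
    ∃ C : ℝ, 0 < C ∧ ∀ μ : ℝ, 0 < μ → μ ≤ 1 →
      Summable (fun k : ℕ =>
        (2 * k + n : ℝ) ^ (2 * n * (1 / p - 1 / 2) - 1) *
          (lam k μ) ^ (2 * (n + m : ℝ) * (1 / p - 1 / 2) - 1) *
          (1 / (α * (2 * k + n : ℝ) ^ α * (lam k μ) ^ (α - 1) +
                2 * β * (lam k μ) ^ (2 * β - 1)))) ∧
      (∑' k : ℕ,
        (2 * k + n : ℝ) ^ (2 * n * (1 / p - 1 / 2) - 1) *
          (lam k μ) ^ (2 * (n + m : ℝ) * (1 / p - 1 / 2) - 1) *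
          (1 / (α * (2 * k + n : ℝ) ^ α * (lam k μ) ^ (α - 1) +
                2 * β * (lam k μ) ^ (2 * β - 1))))
        ≤ C * μ ^ ((2 / α) * (n + m : ℝ) * (1 / p - 1 / 2) - 1) := by
  have hn' : (1 : ℝ) ≤ n := by exact_mod_cast hn
  have hm' : (2 : ℝ) ≤ m := by exact_mod_cast hm
  set s : ℝ := 1 / p - 1 / 2 with hs_def
  have hs : 0 < s := by
    have hp : p < 2 := hp2.trans_lt (by rw [div_lt_iff₀ (by positivity)]; linarith)
    exact sub_pos.mpr (one_div_lt_one_div_of_lt (by linarith) hp)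
  have hsum : Summable fun k : ℕ => (2 * k + n : ℝ) ^ (-(2 * m * s) - 1) :=
    summable_two_mul_add_rpow hn (by
      have : 0 < 2 * (m : ℝ) * s := by positivity
      linarith)
  have hx (k : ℕ) : (0 : ℝ) < 2 * k + n := by positivity
  have htsum : 0 < ∑' k : ℕ, (2 * k + n : ℝ) ^ (-(2 * m * s) - 1) :=
    hsum.tsum_pos (fun k => (Real.rpow_pos_of_pos (hx k) _).le) 0 (Real.rpow_pos_of_pos (hx 0) _)
  refine ⟨1 / α * ∑' k : ℕ, (2 * k + n : ℝ) ^ (-(2 * m * s) - 1), by positivity, ?_⟩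
  intro μ hμ _
  have hle (k : ℕ) := rpow_mul_rpow_mul_deriv_le (a := 2 * n * s - 1) (b := 2 * (n + m : ℝ) * s)
    hα hαβ.le (hx k) (hlam k μ hμ).1 hμ (by positivity) (hlam k μ hμ).2
  have e1 : 2 * n * s - 1 - 2 * (n + m : ℝ) * s = -(2 * m * s) - 1 := by ring
  have e2 : 2 * (n + m : ℝ) * s / α = 2 / α * (n + m : ℝ) * s := by ring
  simp only [e1, e2] at hle
  have hmaj := hsum.mul_left (1 / α * μ ^ (2 / α * (n + m : ℝ) * s - 1))
  have hterm := Summable.of_nonneg_of_le (fun k => by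
    have := (hlam k μ hμ).1
    positivity) hle hmaj
  refine ⟨hterm, (hterm.tsum_le_tsum hle hmaj).trans_eq ?_⟩
  rw [tsum_mul_left]
  ring
end

section
/- Let n ≥ 1 and m ≥ 2 be integers, α, β > 0 real with α < 2β, and 1 ≤ p ≤ (2m+2)/(m+3). Set a = 2n(1/p − 1/2) − 1 and b = 2(n+m)(1/p − 1/2) − 1. For μ > 0 let λ_k(μ) be the unique positive real λ with (2k+n)^α λ^α + λ^{2β} = μ, and set λ_k'(μ) = 1/(α(2k+n)^α λ_k(μ)^{α−1} + 2β λ_k(μ)^{2β−1}). Then there exists a constant C > 0, depending only on n, m, p, α, β, such that for every μ > 1 the series ∑_{k=0}^∞ (2k+n)^a · λ_k(μ)^b · λ_k'(μ) converges and is at most C · μ^{(2/α)(n + (α/(2β))m)(1/p−1/2) − 1}. -/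
/-- Discrete comparison of `x ^ (w - 1)` with the increment of its primitive `x ^ w / w`. -/
theorem rpow_sub_one_le_increment {w x : ℝ} (hw : w ≠ 0) (hx : 1 ≤ x) :
    x ^ (w - 1) ≤ max 1 (2 ^ (1 - w)) * ((x + 1) ^ w / w - x ^ w / w) := by
  have hx0 : 0 < x := by linarith
  obtain ⟨ξ, ⟨h1, h2⟩, h3⟩ := exists_hasDerivAt_eq_slope (fun y : ℝ => y ^ w / w)
    (fun y => y ^ (w - 1)) (show x < x + 1 by linarith)
    (by
      intro y hy
      have hy0 : y ≠ 0 := by linarith [hy.1]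
      exact ((Real.continuousAt_rpow_const y w (Or.inl hy0)).div_const w).continuousWithinAt)
    (by
      intro y hy
      have hy0 : y ≠ 0 := by linarith [hy.1]
      have h := (Real.hasDerivAt_rpow_const (p := w) (Or.inl hy0)).div_const w
      rwa [mul_div_cancel_left₀ _ hw] at h)
  have h4 : (x + 1) ^ w / w - x ^ w / w = ξ ^ (w - 1) := by
    rw [h3]; simp
  rw [h4]
  have hξ : 0 < ξ := by linarith
  have hξp : 0 ≤ ξ ^ (w - 1) := by positivity
  rcases le_total 1 w with h | h
  · calc x ^ (w - 1) ≤ 1 * ξ ^ (w - 1) := by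
          rw [one_mul]; exact Real.rpow_le_rpow hx0.le h1.le (by linarith)
      _ ≤ _ := by gcongr; exact le_max_left _ _
  · have h5 : (2 * x) ^ (w - 1) ≤ ξ ^ (w - 1) :=
      Real.rpow_le_rpow_of_nonpos hξ (by linarith) (by linarith)
    calc x ^ (w - 1) = 2 ^ (1 - w) * (2 * x) ^ (w - 1) := by
          rw [Real.mul_rpow (by norm_num) hx0.le, ← mul_assoc,
            ← Real.rpow_add (by norm_num : (0 : ℝ) < 2)]
          simp
      _ ≤ 2 ^ (1 - w) * ξ ^ (w - 1) := by gcongr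
      _ ≤ _ := by gcongr; exact le_max_right _ _

/-- A primitive, up to constants, of `x ^ (u - 1) * min 1 ((M / x) ^ (u + v))`. -/
noncomputable def truncatedPrimitive (u v M x : ℝ) : ℝ :=
  max 1 (2 ^ (1 - u)) * (min x (M + 1) ^ u / u) +
    M ^ (u + v) * (max 1 (2 ^ (1 - -v)) * (max x M ^ (-v) / (-v)))

theorem truncatedPrimitive_increment {u v M x y : ℝ} (hu : 0 < u) (hv : 0 < v) (hM : 1 ≤ M)
    (hx : 1 ≤ x) (hxy : x + 1 ≤ y) :
    x ^ (u - 1) * min 1 ((M / x) ^ (u + v)) ≤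
      truncatedPrimitive u v M y - truncatedPrimitive u v M x := by
  have hx0 : 0 < x := by linarith
  have hM0 : 0 < M := by linarith
  have hA : ∀ s t : ℝ, 0 ≤ s → s ≤ t → s ^ u / u ≤ t ^ u / u := by
    intro s t hs hst
    gcongr
  have hB : ∀ s t : ℝ, 0 < s → s ≤ t → s ^ (-v) / (-v) ≤ t ^ (-v) / (-v) := by
    intro s t hs hst
    rw [div_neg, div_neg]
    have := Real.rpow_le_rpow_of_nonpos (z := -v) hs hst (by linarith)
    gcongr
  have hA' : min x (M + 1) ^ u / u ≤ min y (M + 1) ^ u / u :=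
    hA _ _ (by positivity) (min_le_min_right _ (by linarith))
  have hB' : max x M ^ (-v) / (-v) ≤ max y M ^ (-v) / (-v) :=
    hB _ _ (by positivity) (max_le_max_right _ (by linarith))
  have hA0 := mul_le_mul_of_nonneg_left hA' (show 0 ≤ max 1 ((2 : ℝ) ^ (1 - u)) by positivity)
  have hB0 := mul_le_mul_of_nonneg_left
    (mul_le_mul_of_nonneg_left hB' (show 0 ≤ max 1 ((2 : ℝ) ^ (1 - -v)) by positivity))
    (show 0 ≤ M ^ (u + v) by positivity)
  unfold truncatedPrimitive
  rcases le_or_gt x M with h | h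
  · have h1 : x ^ (u - 1) * min 1 ((M / x) ^ (u + v)) ≤ x ^ (u - 1) :=
      mul_le_of_le_one_right (by positivity) (min_le_left _ _)
    have h2 := rpow_sub_one_le_increment hu.ne' hx
    have h3 : (x + 1) ^ u / u ≤ min y (M + 1) ^ u / u :=
      hA _ _ (by linarith) (le_min hxy (by linarith))
    have h4 := mul_le_mul_of_nonneg_left h3 (show 0 ≤ max 1 ((2 : ℝ) ^ (1 - u)) by positivity)
    have h5 : min x (M + 1) = x := min_eq_left (by linarith)
    rw [h5] at hA0 ⊢
    linarith
  · have h1 : x ^ (u - 1) * min 1 ((M / x) ^ (u + v)) ≤ M ^ (u + v) * x ^ (-v - 1) := by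
      calc x ^ (u - 1) * min 1 ((M / x) ^ (u + v)) ≤ x ^ (u - 1) * (M / x) ^ (u + v) := by
            gcongr; exact min_le_right _ _
        _ = M ^ (u + v) * x ^ (-v - 1) := by
            rw [Real.div_rpow hM0.le hx0.le, show -v - 1 = (u - 1) - (u + v) by ring,
              Real.rpow_sub hx0 (u - 1)]
            ring
    have h2 := rpow_sub_one_le_increment (w := -v) (by linarith) hx
    have h3 : (x + 1) ^ (-v) / (-v) ≤ max y M ^ (-v) / (-v) :=
      hB _ _ (by linarith) (le_max_of_le_left hxy)
    have h4 := mul_le_mul_of_nonneg_left h3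
      (show 0 ≤ max 1 ((2 : ℝ) ^ (1 - -v)) by positivity)
    have h5 : max x M = x := max_eq_left h.le
    rw [h5] at hB0 ⊢
    have h6 := mul_le_mul_of_nonneg_left (h2.trans (by linarith : _ ≤
      max 1 ((2 : ℝ) ^ (1 - -v)) * (max y M ^ (-v) / (-v)) -
        max 1 ((2 : ℝ) ^ (1 - -v)) * (x ^ (-v) / (-v))))
      (show 0 ≤ M ^ (u + v) by positivity)
    linarith

theorem exists_sum_range_truncated_le {u v : ℝ} (hu : 0 < u) (hv : 0 < v) :
    ∃ C : ℝ, 0 < C ∧ ∀ n : ℕ, 1 ≤ n → ∀ M : ℝ, 1 ≤ M → ∀ K : ℕ,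
      ∑ k ∈ Finset.range K, (2 * k + n : ℝ) ^ (u - 1) * min 1 ((M / (2 * k + n)) ^ (u + v)) ≤
        C * M ^ u := by
  refine ⟨max 1 (2 ^ (1 - u)) * (2 ^ u / u) + max 1 (2 ^ (1 - -v)) / v, by positivity, ?_⟩
  intro n hn M hM K
  have hM0 : 0 < M := by linarith
  have hn' : (1 : ℝ) ≤ n := by exact_mod_cast hn
  set F : ℕ → ℝ := fun k => truncatedPrimitive u v M (2 * k + n) with hF
  have h1 : ∑ k ∈ Finset.range K,
      (2 * k + n : ℝ) ^ (u - 1) * min 1 ((M / (2 * k + n)) ^ (u + v)) ≤ F K - F 0 := by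
    rw [← Finset.sum_range_sub]
    refine Finset.sum_le_sum fun k _ => ?_
    have hk : (0 : ℝ) ≤ k := k.cast_nonneg
    refine truncatedPrimitive_increment hu hv hM (by linarith) ?_
    push_cast
    linarith
  have h2 : F K ≤ max 1 (2 ^ (1 - u)) * (2 ^ u / u) * M ^ u := by
    have ha : min (2 * K + n : ℝ) (M + 1) ^ u ≤ 2 ^ u * M ^ u := by
      rw [← Real.mul_rpow (by norm_num) hM0.le]
      exact Real.rpow_le_rpow (by positivity) ((min_le_right _ _).trans (by linarith)) hu.le
    have hb : 0 ≤ M ^ (u + v) *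
        (max 1 (2 ^ (1 - -v)) * (max (2 * K + n : ℝ) M ^ (-v) / v)) := by positivity
    have hc : max 1 ((2 : ℝ) ^ (1 - u)) * (min (2 * K + n : ℝ) (M + 1) ^ u / u) ≤
        max 1 (2 ^ (1 - u)) * (2 ^ u * M ^ u / u) := by gcongr
    simp only [hF, truncatedPrimitive, div_neg, mul_neg]
    calc _ ≤ max 1 ((2 : ℝ) ^ (1 - u)) * (2 ^ u * M ^ u / u) := by linarith
      _ = _ := by ring
  have h3 : -F 0 ≤ max 1 (2 ^ (1 - -v)) / v * M ^ u := by
    have ha : max (2 * (0 : ℕ) + n : ℝ) M ^ (-v) ≤ M ^ (-v) :=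
      Real.rpow_le_rpow_of_nonpos hM0 (le_max_right _ _) (by linarith)
    have hb : 0 ≤ max 1 ((2 : ℝ) ^ (1 - u)) * (min (2 * (0 : ℕ) + n : ℝ) (M + 1) ^ u / u) := by
      positivity
    have hc : M ^ (u + v) *
        (max 1 ((2 : ℝ) ^ (1 - -v)) * (max (2 * (0 : ℕ) + n : ℝ) M ^ (-v) / v)) ≤
        M ^ (u + v) * (max 1 ((2 : ℝ) ^ (1 - -v)) * (M ^ (-v) / v)) := by gcongr
    have hd : M ^ u = M ^ (u + v) * M ^ (-v) := by
      rw [← Real.rpow_add hM0]; congr 1; ring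
    simp only [hF, truncatedPrimitive, div_neg, mul_neg]
    calc _ ≤ M ^ (u + v) * (max 1 ((2 : ℝ) ^ (1 - -v)) * (M ^ (-v) / v)) := by linarith
      _ = _ := by rw [hd]; ring
  linarith

/-- The dispersion relation `N ^ α * L ^ α + L ^ (2 * β) = μ` turns
`L ^ (d - 1) / (α * N ^ α * L ^ (α - 1) + 2 * β * L ^ (2 * β - 1))` into a truncated power. -/
theorem dispersion_term_le {α β d N L μ : ℝ} (hα : 0 < α) (hαβ : α < 2 * β) (hd : 0 < d)
    (hN : 0 < N) (hL : 0 < L) (h : N ^ α * L ^ α + L ^ (2 * β) = μ) :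
    L ^ (d - 1) * (1 / (α * N ^ α * L ^ (α - 1) + 2 * β * L ^ (2 * β - 1))) ≤
      1 / α * μ ^ (d / (2 * β) - 1) * min 1 ((μ ^ (1 / α - 1 / (2 * β)) / N) ^ d) := by
  have hβ : 0 < 2 * β := hα.trans hαβ
  have hp1 : 0 < N ^ α * L ^ α := by positivity
  have hp2 : 0 < L ^ (2 * β) := by positivity
  have hμ : 0 < μ := by linarith
  have hL1 : L ≤ μ ^ (1 / (2 * β)) := by
    calc L = (L ^ (2 * β)) ^ (1 / (2 * β)) := by
          rw [← Real.rpow_mul hL.le, mul_one_div_cancel hβ.ne', Real.rpow_one]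
      _ ≤ _ := Real.rpow_le_rpow hp2.le (by linarith) (by positivity)
  have hL2 : N * L ≤ μ ^ (1 / α) := by
    calc N * L = ((N * L) ^ α) ^ (1 / α) := by
          rw [← Real.rpow_mul (by positivity), mul_one_div_cancel hα.ne', Real.rpow_one]
      _ ≤ _ := Real.rpow_le_rpow (by positivity)
          (by rw [Real.mul_rpow hN.le hL.le]; linarith) (by positivity)
  have hpow : (μ ^ (1 / (2 * β))) ^ d = μ ^ (d / (2 * β)) := by
    rw [← Real.rpow_mul hμ.le]; congr 1; ring
  have hLd : L ^ d ≤ μ ^ (d / (2 * β)) * min 1 ((μ ^ (1 / α - 1 / (2 * β)) / N) ^ d) := by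
    rw [mul_min_of_nonneg _ _ (by positivity)]
    refine le_min ?_ ?_
    · rw [mul_one, ← hpow]
      exact Real.rpow_le_rpow hL.le hL1 hd.le
    · rw [← hpow, ← Real.mul_rpow (by positivity) (by positivity)]
      refine Real.rpow_le_rpow hL.le ?_ hd.le
      rw [← mul_div_assoc, ← Real.rpow_add hμ, le_div_iff₀ hN, mul_comm L]
      simpa using hL2
  have hden : α * μ / L ≤ α * N ^ α * L ^ (α - 1) + 2 * β * L ^ (2 * β - 1) := by
    rw [Real.rpow_sub_one hL.ne', Real.rpow_sub_one hL.ne', ← mul_div_assoc, ← mul_div_assoc,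
      ← add_div]
    gcongr
    nlinarith
  calc _ ≤ L ^ (d - 1) * (1 / (α * μ / L)) := by gcongr
    _ = 1 / α * μ⁻¹ * L ^ d := by
        rw [Real.rpow_sub_one hL.ne']; field_simp
    _ ≤ 1 / α * μ⁻¹ *
        (μ ^ (d / (2 * β)) * min 1 ((μ ^ (1 / α - 1 / (2 * β)) / N) ^ d)) := by gcongr
    _ = _ := by rw [Real.rpow_sub_one hμ.ne']; ring


/-- (case `α < 2β`, `μ > 1`) Bound for the series
`∑_k (2k+n)^a (lam k μ)^b (lam k μ)'` by `C μ^((2/α)(n+(α/(2β))m)(1/p−1/2) − 1)`. -/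
theorem stmt9 (n m : ℕ) (hn : 1 ≤ n) (hm : 2 ≤ m) (α β : ℝ) (hα : 0 < α) (hβ : 0 < β)
    (hαβ : α < 2 * β) (p : ℝ) (hp1 : 1 ≤ p) (hp2 : p ≤ (2 * m + 2) / (m + 3))
    (lam : ℕ → ℝ → ℝ)
    (hlam : ∀ k : ℕ, ∀ μ : ℝ, 0 < μ → 0 < lam k μ ∧
      (2 * k + n : ℝ) ^ α * (lam k μ) ^ α + (lam k μ) ^ (2 * β) = μ) :
    ∃ C : ℝ, 0 < C ∧ ∀ μ : ℝ, 1 < μ →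
      Summable (fun k : ℕ =>
        (2 * k + n : ℝ) ^ (2 * n * (1 / p - 1 / 2) - 1) *
          (lam k μ) ^ (2 * (n + m : ℝ) * (1 / p - 1 / 2) - 1) *
          (1 / (α * (2 * k + n : ℝ) ^ α * (lam k μ) ^ (α - 1) +
                2 * β * (lam k μ) ^ (2 * β - 1)))) ∧
      (∑' k : ℕ,
        (2 * k + n : ℝ) ^ (2 * n * (1 / p - 1 / 2) - 1) *
          (lam k μ) ^ (2 * (n + m : ℝ) * (1 / p - 1 / 2) - 1) *
          (1 / (α * (2 * k + n : ℝ) ^ α * (lam k μ) ^ (α - 1) +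
                2 * β * (lam k μ) ^ (2 * β - 1))))
        ≤ C * μ ^ ((2 / α) * ((n : ℝ) + (α / (2 * β)) * m) * (1 / p - 1 / 2) - 1) := by
  have hp0 : 0 < p := by linarith
  have hm0 : (0 : ℝ) ≤ m := m.cast_nonneg
  have hm1 : (2 : ℝ) ≤ m := by exact_mod_cast hm
  have hn1 : (1 : ℝ) ≤ n := by exact_mod_cast hn
  have hs : 0 < 1 / p - 1 / 2 := by
    have hlt : p < 2 := hp2.trans_lt (by rw [div_lt_iff₀ (by positivity)]; linarith)
    exact sub_pos.mpr (one_div_lt_one_div_of_lt hp0 hlt)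
  set s : ℝ := 1 / p - 1 / 2
  have hu : 0 < 2 * n * s := by positivity
  have hv : 0 < 2 * m * s := by positivity
  obtain ⟨C, hC, hsum⟩ := exists_sum_range_truncated_le hu hv
  refine ⟨1 / α * C, by positivity, fun μ hμ => ?_⟩
  have hμ0 : 0 < μ := by linarith
  have hM : 1 ≤ μ ^ (1 / α - 1 / (2 * β)) :=
    Real.one_le_rpow hμ.le (sub_nonneg.mpr (one_div_le_one_div_of_le hα hαβ.le))
  have hd : 2 * (n + m : ℝ) * s = 2 * n * s + 2 * m * s := by ring
  set f : ℕ → ℝ := fun k : ℕ =>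
        (2 * k + n : ℝ) ^ (2 * n * s - 1) *
          (lam k μ) ^ (2 * (n + m : ℝ) * s - 1) *
          (1 / (α * (2 * k + n : ℝ) ^ α * (lam k μ) ^ (α - 1) +
                2 * β * (lam k μ) ^ (2 * β - 1))) with hf
  have hf0 : ∀ k, 0 ≤ f k := by
    intro k
    have := (hlam k μ hμ0).1
    positivity
  have hfle : ∀ K : ℕ, ∑ k ∈ Finset.range K, f k ≤
      1 / α * C * μ ^ ((2 / α) * ((n : ℝ) + (α / (2 * β)) * m) * s - 1) := by
    intro K
    calc ∑ k ∈ Finset.range K, f k ≤ ∑ k ∈ Finset.range K,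
          1 / α * μ ^ (2 * (n + m : ℝ) * s / (2 * β) - 1) *
            ((2 * k + n : ℝ) ^ (2 * n * s - 1) *
              min 1 ((μ ^ (1 / α - 1 / (2 * β)) / (2 * k + n)) ^ (2 * n * s + 2 * m * s))) := by
          refine Finset.sum_le_sum fun k _ => ?_
          have hN : (0 : ℝ) < 2 * k + n := by positivity
          have h := mul_le_mul_of_nonneg_left
            (dispersion_term_le hα hαβ (by positivity : 0 < 2 * (n + m : ℝ) * s) hN
              (hlam k μ hμ0).1 (hlam k μ hμ0).2)
            (show 0 ≤ (2 * k + n : ℝ) ^ (2 * n * s - 1) by positivity)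
          rw [← hd]
          simp only [hf]
          linarith
      _ ≤ 1 / α * μ ^ (2 * (n + m : ℝ) * s / (2 * β) - 1) *
          (C * (μ ^ (1 / α - 1 / (2 * β))) ^ (2 * n * s)) := by
          rw [← Finset.mul_sum]
          gcongr
          exact hsum n hn _ hM K
      _ = 1 / α * C * (μ ^ (2 * (n + m : ℝ) * s / (2 * β) - 1) *
          μ ^ ((1 / α - 1 / (2 * β)) * (2 * n * s))) := by
          rw [Real.rpow_mul hμ0.le]; ring
      _ = _ := by
          rw [← Real.rpow_add hμ0]
          congr 2
          field_simp
          ring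
  exact ⟨summable_of_sum_range_le hf0 hfle, Real.tsum_le_of_sum_range_le hf0 hfle⟩
end

section
/- Let n ≥ 1 and m ≥ 2 be integers, α, β > 0 real with α > 2β, and 1 ≤ p ≤ (2m+2)/(m+3). Set a = 2n(1/p − 1/2) − 1 and b = 2(n+m)(1/p − 1/2) − 1. For μ > 0 let λ_k(μ) be the unique positive real λ with (2k+n)^α λ^α + λ^{2β} = μ, and set λ_k'(μ) = 1/(α(2k+n)^α λ_k(μ)^{α−1} + 2β λ_k(μ)^{2β−1}). Then there exists a constant C > 0, depending only on n, m, p, α, β, such that for every μ with 0 < μ ≤ 1 the series ∑_{k=0}^∞ (2k+n)^a · λ_k(μ)^b · λ_k'(μ) converges and is at most C · μ^{(2/α)(n + (α/(2β))m)(1/p−1/2) − 1}. -/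
/-- The derivative of `x ↦ (x / (x + X)) ^ u` at `N ≥ 1` is controlled by its increment over
`[N, N + 2]`. -/
lemma rpow_mul_div_rpow_add_le_increment {u X N : ℝ} (hu : 0 < u) (hX : 0 < X) (hN : 1 ≤ N) :
    N ^ (u - 1) * (X / (N + X) ^ (u + 1)) ≤
      3 ^ (u + 2) / (2 * u) *
        (((N + 2) / (N + 2 + X)) ^ u - (N / (N + X)) ^ u) := by
  have hderiv : ∀ x : ℝ, 0 < x → HasDerivAt (fun x : ℝ => (x / (x + X)) ^ u)
      (u * (x ^ (u - 1) * (X / (x + X) ^ (u + 1)))) x := by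
    intro x hx
    have hxX : 0 < x + X := by positivity
    have hdiv : HasDerivAt (fun x : ℝ => x / (x + X)) ((1 * (x + X) - x * 1) / (x + X) ^ 2) x :=
      (hasDerivAt_id x).div ((hasDerivAt_id x).add_const X) hxX.ne'
    convert hdiv.rpow_const (p := u) (Or.inl (by positivity)) using 1
    rw [Real.div_rpow hx.le hxX.le, Real.rpow_sub_one hxX.ne', Real.rpow_add_one hxX.ne']
    field_simp
    ring
  obtain ⟨ξ, ⟨h1, h2⟩, h3⟩ := exists_hasDerivAt_eq_slope (fun x : ℝ => (x / (x + X)) ^ u)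
    (fun x => u * (x ^ (u - 1) * (X / (x + X) ^ (u + 1)))) (show N < N + 2 by linarith)
    (fun x hx => (hderiv x (by linarith [hx.1])).continuousAt.continuousWithinAt)
    (fun x hx => hderiv x (by linarith [hx.1]))
  have hN0 : 0 < N := by linarith
  have hξ : 0 < ξ := by linarith
  have hincr : ((N + 2) / (N + 2 + X)) ^ u - (N / (N + X)) ^ u =
      2 * u * (ξ ^ (u - 1) * (X / (ξ + X) ^ (u + 1))) := by
    rw [show N + 2 - N = (2 : ℝ) by ring] at h3
    linarith
  have hpow : N ^ (u - 1) ≤ 3 * ξ ^ (u - 1) := by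
    rw [Real.rpow_sub_one hN0.ne', Real.rpow_sub_one hξ.ne', ← mul_div_assoc,
      div_le_div_iff₀ hN0 hξ]
    have := Real.rpow_le_rpow hN0.le h1.le hu.le
    calc N ^ u * ξ ≤ ξ ^ u * (3 * N) := by gcongr; linarith
      _ = 3 * ξ ^ u * N := by ring
  have hden : X / (N + X) ^ (u + 1) ≤ 3 ^ (u + 1) * (X / (ξ + X) ^ (u + 1)) := by
    have : (ξ + X) ^ (u + 1) ≤ 3 ^ (u + 1) * (N + X) ^ (u + 1) := by
      rw [← Real.mul_rpow (by norm_num) (by positivity)]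
      exact Real.rpow_le_rpow (by positivity) (by linarith) (by linarith)
    rw [← mul_div_assoc, div_le_div_iff₀ (by positivity) (by positivity)]
    calc X * (ξ + X) ^ (u + 1) ≤ X * (3 ^ (u + 1) * (N + X) ^ (u + 1)) := by gcongr
      _ = 3 ^ (u + 1) * X * (N + X) ^ (u + 1) := by ring
  rw [hincr]
  calc N ^ (u - 1) * (X / (N + X) ^ (u + 1))
      ≤ (3 * ξ ^ (u - 1)) * (3 ^ (u + 1) * (X / (ξ + X) ^ (u + 1))) := by gcongr
    _ = 3 ^ (u + 2) / (2 * u) * (2 * u * (ξ ^ (u - 1) * (X / (ξ + X) ^ (u + 1)))) := by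
      rw [show u + 2 = (u + 1) + 1 by ring, Real.rpow_add_one (by norm_num : (3 : ℝ) ≠ 0) (u + 1)]
      field_simp

/-- Partial sums of `N ^ (u - 1) * X / (N + X) ^ (u + 1)` along `N = 2 k + n` are bounded
uniformly in `X`. -/
lemma sum_range_rpow_mul_div_rpow_add_le {u X : ℝ} (hu : 0 < u) (hX : 0 < X) {n : ℕ} (hn : 1 ≤ n)
    (K : ℕ) :
    ∑ k ∈ Finset.range K, (2 * k + n : ℝ) ^ (u - 1) * (X / (2 * k + n + X) ^ (u + 1)) ≤
      3 ^ (u + 2) / (2 * u) := by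
  have hn' : (1 : ℝ) ≤ n := by exact_mod_cast hn
  set G : ℕ → ℝ := fun k => ((2 * k + n : ℝ) / (2 * k + n + X)) ^ u with hG
  calc ∑ k ∈ Finset.range K, (2 * k + n : ℝ) ^ (u - 1) * (X / (2 * k + n + X) ^ (u + 1))
      ≤ ∑ k ∈ Finset.range K, 3 ^ (u + 2) / (2 * u) * (G (k + 1) - G k) := by
        refine Finset.sum_le_sum fun k _ => ?_
        have hk : (0 : ℝ) ≤ k := k.cast_nonneg
        have h := rpow_mul_div_rpow_add_le_increment (N := 2 * k + n) hu hX (by linarith)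
        rw [show (2 * k + n + 2 : ℝ) = 2 * ((k + 1 : ℕ) : ℝ) + n by push_cast; ring] at h
        exact h
    _ = 3 ^ (u + 2) / (2 * u) * (G K - G 0) := by rw [← Finset.mul_sum, Finset.sum_range_sub]
    _ ≤ 3 ^ (u + 2) / (2 * u) * 1 := by
        have h0 : 0 ≤ G 0 := by simp only [hG]; positivity
        have h1 : G K ≤ 1 := Real.rpow_le_one (by positivity)
          (div_le_one_of_le₀ (by linarith) (by positivity)) hu.le
        gcongr
        linarith
    _ = 3 ^ (u + 2) / (2 * u) := mul_one _

/-- If `l ≤ A` and `N * l ≤ B`, then `l ^ (u + v)` is bounded by a multiple of `A ^ v * B ^ u`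
with a factor decaying in `N`. -/
lemma rpow_add_le_of_le_of_mul_le {A B N l u v : ℝ} (hA : 0 < A) (hB : 0 < B) (hN : 0 < N)
    (hl : 0 < l) (hu : 0 < u) (hv : 1 ≤ v) (hlA : l ≤ A) (hlB : N * l ≤ B) :
    l ^ (u + v) ≤ 2 ^ (u + 1) * (A ^ v * B ^ u) * (B / A / (N + B / A) ^ (u + 1)) := by
  have hX : 0 < B / A := by positivity
  have hsum : l * (N + B / A) ≤ 2 * B := by
    have : l * (B / A) ≤ A * (B / A) := by gcongr
    rw [mul_div_cancel₀ _ hA.ne'] at this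
    linarith
  have hle : l ≤ 2 * B / (N + B / A) := by rwa [le_div_iff₀ (by positivity)]
  calc l ^ (u + v) = l ^ (v - 1) * l ^ (u + 1) := by
        rw [← Real.rpow_add hl]; congr 1; ring
    _ ≤ A ^ (v - 1) * (2 * B / (N + B / A)) ^ (u + 1) := by
        have := Real.rpow_le_rpow hl.le hlA (sub_nonneg.2 hv)
        have := Real.rpow_le_rpow hl.le hle (by linarith : 0 ≤ u + 1)
        gcongr
    _ = _ := by
        rw [Real.div_rpow (by positivity) (by positivity), Real.mul_rpow (by norm_num) hB.le,
          Real.rpow_sub_one hA.ne', Real.rpow_add_one hB.ne']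
        field_simp


/-- (case `α > 2β`, `0 < μ ≤ 1`) Bound for the series
`∑_k (2k+n)^a (lam k μ)^b (lam k μ)'` by `C μ^((2/α)(n+(α/(2β))m)(1/p−1/2) − 1)`. -/
theorem stmt11 (n m : ℕ) (hn : 1 ≤ n) (hm : 2 ≤ m) (α β : ℝ) (hα : 0 < α) (hβ : 0 < β)
    (hαβ : 2 * β < α) (p : ℝ) (hp1 : 1 ≤ p) (hp2 : p ≤ (2 * m + 2) / (m + 3))
    (lam : ℕ → ℝ → ℝ)
    (hlam : ∀ k : ℕ, ∀ μ : ℝ, 0 < μ → 0 < lam k μ ∧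
      (2 * k + n : ℝ) ^ α * (lam k μ) ^ α + (lam k μ) ^ (2 * β) = μ) :
    ∃ C : ℝ, 0 < C ∧ ∀ μ : ℝ, 0 < μ → μ ≤ 1 →
      Summable (fun k : ℕ =>
        (2 * k + n : ℝ) ^ (2 * n * (1 / p - 1 / 2) - 1) *
          (lam k μ) ^ (2 * (n + m : ℝ) * (1 / p - 1 / 2) - 1) *
          (1 / (α * (2 * k + n : ℝ) ^ α * (lam k μ) ^ (α - 1) +
                2 * β * (lam k μ) ^ (2 * β - 1)))) ∧
      (∑' k : ℕ,
        (2 * k + n : ℝ) ^ (2 * n * (1 / p - 1 / 2) - 1) *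
          (lam k μ) ^ (2 * (n + m : ℝ) * (1 / p - 1 / 2) - 1) *
          (1 / (α * (2 * k + n : ℝ) ^ α * (lam k μ) ^ (α - 1) +
                2 * β * (lam k μ) ^ (2 * β - 1))))
        ≤ C * μ ^ ((2 / α) * ((n : ℝ) + (α / (2 * β)) * m) * (1 / p - 1 / 2) - 1) := by
  have hn' : (1 : ℝ) ≤ n := by exact_mod_cast hn
  have hm' : (2 : ℝ) ≤ m := by exact_mod_cast hm
  set s : ℝ := 1 / p - 1 / 2 with hs
  have hp0 : 0 < p := by linarith
  have hs1 : 1 / (m + 1 : ℝ) ≤ s := by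
    have h : 1 / ((2 * m + 2) / (m + 3) : ℝ) ≤ 1 / p := one_div_le_one_div_of_le hp0 hp2
    have h' : 1 / ((2 * m + 2) / (m + 3) : ℝ) - 1 / 2 = 1 / (m + 1) := by
      field_simp
      ring
    linarith
  have hs0 : 0 < s := lt_of_lt_of_le (by positivity) hs1
  obtain ⟨u, hu⟩ : ∃ u : ℝ, u = 2 * n * s := ⟨_, rfl⟩
  obtain ⟨v, hv⟩ : ∃ v : ℝ, v = 2 * m * s := ⟨_, rfl⟩
  have hu0 : 0 < u := by rw [hu]; positivity
  have hv1 : 1 ≤ v := by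
    rw [div_le_iff₀ (by positivity)] at hs1
    nlinarith
  refine ⟨2 ^ (u + 1) / (2 * β) * (3 ^ (u + 2) / (2 * u)), by positivity, fun μ hμ _ => ?_⟩
  rw [show 2 * (n + m : ℝ) * s - 1 = u + v - 1 by rw [hu, hv]; ring, ← hu,
    show 2 / α * (n + α / (2 * β) * m) * s - 1 = 1 / (2 * β) * v + 1 / α * u - 1 by
      rw [hu, hv]; field_simp; ring]
  set A : ℝ := μ ^ (1 / (2 * β)) with hAdef
  set B : ℝ := μ ^ (1 / α) with hBdef
  have hA : 0 < A := Real.rpow_pos_of_pos hμ _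
  have hB : 0 < B := Real.rpow_pos_of_pos hμ _
  have hAB : A ^ v * B ^ u / μ = μ ^ (1 / (2 * β) * v + 1 / α * u - 1) := by
    rw [hAdef, hBdef, ← Real.rpow_mul hμ.le, ← Real.rpow_mul hμ.le, ← Real.rpow_add hμ,
      ← Real.rpow_sub_one hμ.ne']
  set M : ℝ := 2 ^ (u + 1) / (2 * β) * (A ^ v * B ^ u / μ) with hM
  have hM0 : 0 ≤ M := by positivity
  have hterm : ∀ k : ℕ, (2 * k + n : ℝ) ^ (u - 1) * lam k μ ^ (u + v - 1) *
      (1 / (α * (2 * k + n : ℝ) ^ α * lam k μ ^ (α - 1) + 2 * β * lam k μ ^ (2 * β - 1))) ≤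
      M * ((2 * k + n : ℝ) ^ (u - 1) * (B / A / (2 * k + n + B / A) ^ (u + 1))) := by
    intro k
    obtain ⟨hl, heq⟩ := hlam k μ hμ
    set l := lam k μ
    have hN : (0 : ℝ) < 2 * k + n := by positivity
    set N : ℝ := 2 * k + n
    have hlA : l ≤ A := by
      rw [hAdef, one_div, Real.le_rpow_inv_iff_of_pos hl.le hμ.le (by positivity)]
      linarith [show 0 < N ^ α * l ^ α by positivity]
    have hlB : N * l ≤ B := by
      rw [hBdef, one_div, Real.le_rpow_inv_iff_of_pos (by positivity) hμ.le hα,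
        Real.mul_rpow hN.le hl.le]
      linarith [show 0 < l ^ (2 * β) by positivity]
    have hderiv : 1 / (α * N ^ α * l ^ (α - 1) + 2 * β * l ^ (2 * β - 1)) ≤ l / (2 * β * μ) := by
      rw [div_le_div_iff₀ (by positivity) (by positivity), Real.rpow_sub_one hl.ne',
        Real.rpow_sub_one hl.ne']
      have : l * (α * N ^ α * (l ^ α / l) + 2 * β * (l ^ (2 * β) / l)) =
          α * (N ^ α * l ^ α) + 2 * β * l ^ (2 * β) := by field_simp
      rw [this, ← heq]
      have := mul_le_mul_of_nonneg_right hαβ.le (show 0 ≤ N ^ α * l ^ α by positivity)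
      linarith
    calc N ^ (u - 1) * l ^ (u + v - 1) *
          (1 / (α * N ^ α * l ^ (α - 1) + 2 * β * l ^ (2 * β - 1)))
        ≤ N ^ (u - 1) * l ^ (u + v - 1) * (l / (2 * β * μ)) := by gcongr
      _ = N ^ (u - 1) * l ^ (u + v) / (2 * β * μ) := by
          rw [Real.rpow_sub_one hl.ne']
          field_simp
      _ ≤ N ^ (u - 1) * (2 ^ (u + 1) * (A ^ v * B ^ u) * (B / A / (N + B / A) ^ (u + 1))) /
            (2 * β * μ) := by
          have := rpow_add_le_of_le_of_mul_le hA hB hN hl hu0 hv1 hlA hlB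
          gcongr
      _ = M * (N ^ (u - 1) * (B / A / (N + B / A) ^ (u + 1))) := by
          rw [hM]
          ring
  have hnonneg : ∀ k : ℕ, 0 ≤ (2 * k + n : ℝ) ^ (u - 1) * lam k μ ^ (u + v - 1) *
      (1 / (α * (2 * k + n : ℝ) ^ α * lam k μ ^ (α - 1) + 2 * β * lam k μ ^ (2 * β - 1))) := by
    intro k
    have hl := (hlam k μ hμ).1
    positivity
  have hpartial : ∀ K : ℕ, ∑ k ∈ Finset.range K,
      (2 * k + n : ℝ) ^ (u - 1) * lam k μ ^ (u + v - 1) *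
      (1 / (α * (2 * k + n : ℝ) ^ α * lam k μ ^ (α - 1) + 2 * β * lam k μ ^ (2 * β - 1))) ≤
      2 ^ (u + 1) / (2 * β) * (3 ^ (u + 2) / (2 * u)) *
        μ ^ (1 / (2 * β) * v + 1 / α * u - 1) := by
    intro K
    refine (Finset.sum_le_sum fun k _ => hterm k).trans ?_
    rw [← Finset.mul_sum]
    refine (mul_le_mul_of_nonneg_left (sum_range_rpow_mul_div_rpow_add_le hu0
      (div_pos hB hA) hn K) hM0).trans_eq ?_
    rw [hM, hAB]
    ring
  exact ⟨summable_of_sum_range_le hnonneg hpartial, Real.tsum_le_of_sum_range_le hnonneg hpartial⟩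
end

section
/- Let n, m ≥ 1 be integers. Suppose there exist real 2n×2n matrices U^1, ..., U^m such that each U^j is skew-symmetric ((U^j)ᵀ = −U^j) and orthogonal ((U^j)ᵀ U^j = I), and U^i U^j + U^j U^i = 0 for all i ≠ j. Then m + 1 ≤ 2n. -/
open Matrix

/-- A Hurwitz–Radon family of real `n × n` matrices (`n` nonempty) has at most `n` members:
the columns of index `k` of its members are orthonormal, for each `k`. -/
theorem card_le_of_hurwitz_radon {ι κ : Type*} [Fintype ι] [DecidableEq ι] [Fintype κ]
    [DecidableEq κ] [Nonempty κ] (V : ι → Matrix κ κ ℝ)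
    (horth : ∀ a, (V a)ᵀ * V a = 1)
    (hanti : ∀ a b, a ≠ b → (V a)ᵀ * V b + (V b)ᵀ * V a = 0) :
    Fintype.card ι ≤ Fintype.card κ := by
  obtain ⟨k⟩ := ‹Nonempty κ›
  let W : Matrix ι κ ℝ := .of fun a l ↦ V a l k
  have entry (a b : ι) : (W * Wᵀ) a b = ((V a)ᵀ * V b) k k := by simp [W, mul_apply]
  have gram : W * Wᵀ = 1 := by
    ext a b
    rw [entry]
    obtain rfl | hab := eq_or_ne a b
    · simp [horth]
    · have hsum := congrFun₂ (hanti a b hab) k k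
      have hsymm : ((V b)ᵀ * V a) k k = ((V a)ᵀ * V b) k k := by
        simp [mul_apply, mul_comm]
      rw [Matrix.add_apply, hsymm, Matrix.zero_apply] at hsum
      rw [one_apply_ne hab]
      linarith
  calc Fintype.card ι = (W * Wᵀ).rank := by rw [gram, rank_one]
    _ ≤ W.rank := rank_mul_le_left _ _
    _ ≤ Fintype.card κ := rank_le_card_width _

/-- If there exist `2n×2n` real matrices `U^1, …, U^m` which are
skew-symmetric, orthogonal, and pairwise anticommuting, then `m + 1 ≤ 2n`. -/
theorem stmt15 (n m : ℕ) (hn : 1 ≤ n) (hm : 1 ≤ m)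
    (U : Fin m → Matrix (Fin (2 * n)) (Fin (2 * n)) ℝ)
    (hskew : ∀ j, (U j)ᵀ = -U j)
    (horth : ∀ j, (U j)ᵀ * U j = 1)
    (hanti : ∀ i j, i ≠ j → U i * U j + U j * U i = 0) :
    m + 1 ≤ 2 * n := by
  have : Nonempty (Fin (2 * n)) := ⟨⟨0, by omega⟩⟩
  have key := card_le_of_hurwitz_radon (fun a : Option (Fin m) ↦ a.elim 1 U)
    (by rintro (_ | j) <;> simp [horth])
    (by
      rintro (_ | i) (_ | j) hij
      · exact absurd rfl hij
      · simp [hskew]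
      · simp [hskew]
      · have hne : i ≠ j := fun h ↦ hij (congrArg some h)
        simp only [Option.elim, hskew, neg_mul]
        rw [← neg_add, hanti i j hne, neg_zero])
  simpa using key
end
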